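/- Let V be a finite-dimensional real vector space, σ a convex polyhedral cone in V, W a linear subspace of V, and σ_W the smallest face of σ containing W ∩ σ. Then Ŵ := σ_W + W is the smallest face of the convex polyhedral cone σ + W; in particular, Ŵ equals (σ+W) ∩ −(σ+W) and is a linear subspace of V. -/

import Mathlib

open scoped Pointwise

/-- A (not necessarily strictly) convex cone, as a subset of a real vector space:
it contains `0` and is closed under addition and under scaling by nonnegative reals. -/
def IsConeSet {V : Type*} [AddCommGroup V] [Module ℝ V] (τ : Set V) : Prop :=
  (0 : V) ∈ τ ∧ (∀ x ∈ τ, ∀ y ∈ τ, x + y ∈ τ) ∧ ∀ c : ℝ, 0 ≤ c → ∀ x ∈ τ, c • x ∈ τ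

/-- `τ` is a face of the convex cone `σ`: a convex subcone such that whenever the sum of
two elements of `σ` lies in `τ`, both elements lie in `τ`. -/
def IsFaceOf {V : Type*} [AddCommGroup V] [Module ℝ V] (τ σ : Set V) : Prop :=
  IsConeSet τ ∧ τ ⊆ σ ∧ ∀ x ∈ σ, ∀ y ∈ σ, x + y ∈ τ → x ∈ τ ∧ y ∈ τ

/-- A convex polyhedral cone in a real vector space: the set of all nonnegative linear
combinations of finitely many vectors. -/
def IsPolyCone {V : Type*} [AddCommGroup V] [Module ℝ V] (σ : Set V) : Prop :=
  ∃ (m : ℕ) (g : Fin m → V),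
    σ = { x | ∃ c : Fin m → ℝ, (∀ k, 0 ≤ c k) ∧ x = ∑ k, c k • g k }

/-- The smallest face of the cone `σ` containing the subset `A ⊆ σ`. -/
def minFaceContaining {V : Type*} [AddCommGroup V] [Module ℝ V] (σ A : Set V) : Set V :=
  ⋂₀ { τ | IsFaceOf τ σ ∧ A ⊆ τ }

section

variable {V : Type*} [AddCommGroup V] [Module ℝ V]

theorem IsPolyCone.isConeSet {σ : Set V} (hσ : IsPolyCone σ) : IsConeSet σ := by
  obtain ⟨m, g, rfl⟩ := hσ
  refine ⟨⟨0, fun _ => le_rfl, by simp⟩, ?_, ?_⟩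
  · rintro _ ⟨a, ha, rfl⟩ _ ⟨b, hb, rfl⟩
    exact ⟨a + b, fun k => add_nonneg (ha k) (hb k), by
      simp [add_smul, Finset.sum_add_distrib]⟩
  · rintro c hc _ ⟨a, ha, rfl⟩
    exact ⟨c • a, fun k => mul_nonneg hc (ha k), by simp [Finset.smul_sum, mul_smul]⟩

theorem IsConeSet.add_submodule {σ : Set V} (hσ : IsConeSet σ) (W : Submodule ℝ V) :
    IsConeSet (σ + (W : Set V)) := by
  obtain ⟨h0, hadd, hsmul⟩ := hσ
  refine ⟨⟨0, h0, 0, W.zero_mem, add_zero 0⟩, ?_, ?_⟩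
  · rintro _ ⟨x, hx, w, hw, rfl⟩ _ ⟨y, hy, u, hu, rfl⟩
    exact ⟨x + y, hadd x hx y hy, w + u, W.add_mem hw hu, add_add_add_comm x y w u⟩
  · rintro c hc _ ⟨x, hx, w, hw, rfl⟩
    exact ⟨c • x, hsmul c hc x hx, c • w, W.smul_mem c hw, (smul_add c x w).symm⟩

/-- The lineality space of a convex cone, the largest subspace contained in it. -/
def IsConeSet.lineality {σ : Set V} (hσ : IsConeSet σ) : Submodule ℝ V where
  carrier := σ ∩ -σ
  zero_mem' := ⟨hσ.1, by simpa using hσ.1⟩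
  add_mem' := by
    rintro x y ⟨hx, hx'⟩ ⟨hy, hy'⟩
    refine ⟨hσ.2.1 x hx y hy, ?_⟩
    rw [Set.mem_neg, neg_add]
    exact hσ.2.1 _ hx' _ hy'
  smul_mem' := by
    rintro c x ⟨hx, hx'⟩
    rw [Set.mem_neg] at hx'
    rcases le_total 0 c with hc | hc
    · refine ⟨hσ.2.2 c hc x hx, ?_⟩
      rw [Set.mem_neg, ← smul_neg]
      exact hσ.2.2 c hc _ hx'
    · have hc' : 0 ≤ -c := neg_nonneg.2 hc
      refine ⟨?_, ?_⟩
      · rw [← neg_smul_neg]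
        exact hσ.2.2 _ hc' _ hx'
      · rw [Set.mem_neg, ← neg_smul]
        exact hσ.2.2 _ hc' x hx

theorem IsConeSet.isFaceOf_inter_neg {σ : Set V} (hσ : IsConeSet σ) : IsFaceOf (σ ∩ -σ) σ := by
  have left_mem : ∀ x ∈ σ, ∀ y ∈ σ, x + y ∈ σ ∩ -σ → x ∈ σ ∩ -σ := fun x hx y hy h =>
    ⟨hx, by simpa using hσ.2.1 _ h.2 y hy⟩
  exact ⟨⟨hσ.lineality.zero_mem, fun _ hx _ hy => hσ.lineality.add_mem hx hy,
    fun c _ _ hx => hσ.lineality.smul_mem c hx⟩, Set.inter_subset_left,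
    fun x hx y hy h => ⟨left_mem x hx y hy h, left_mem y hy x hx (by rwa [add_comm])⟩⟩

theorem IsFaceOf.inter_neg_subset {τ σ : Set V} (hτ : IsFaceOf τ σ) : σ ∩ -σ ⊆ τ :=
  fun x hx => (hτ.2.2 x hx.1 (-x) hx.2 (by simpa using hτ.1.1)).1

theorem IsConeSet.isFaceOf_setOf_add_mem {σ : Set V} (hσ : IsConeSet σ) (W : Submodule ℝ V) :
    IsFaceOf {x | x ∈ σ ∧ ∃ y ∈ σ, x + y ∈ W} σ := by
  obtain ⟨h0, hadd, hsmul⟩ := hσ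
  refine ⟨⟨⟨h0, 0, h0, by simp⟩, ?_, ?_⟩, fun x hx => hx.1, ?_⟩
  · rintro x ⟨hx, a, ha, hxa⟩ y ⟨hy, b, hb, hyb⟩
    refine ⟨hadd x hx y hy, a + b, hadd a ha b hb, ?_⟩
    rw [add_add_add_comm]
    exact W.add_mem hxa hyb
  · rintro c hc x ⟨hx, a, ha, hxa⟩
    refine ⟨hsmul c hc x hx, c • a, hsmul c hc a ha, ?_⟩
    rw [← smul_add]
    exact W.smul_mem c hxa
  · rintro x hx y hy ⟨-, z, hz, h⟩
    refine ⟨⟨hx, y + z, hadd y hy z hz, by rwa [← add_assoc]⟩,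
      ⟨hy, x + z, hadd x hx z hz, ?_⟩⟩
    rwa [← add_assoc, add_comm y x]

theorem IsConeSet.minFaceContaining_submodule_inter {σ : Set V} (hσ : IsConeSet σ)
    (W : Submodule ℝ V) :
    minFaceContaining σ ((W : Set V) ∩ σ) = {x | x ∈ σ ∧ ∃ y ∈ σ, x + y ∈ W} := by
  apply Set.Subset.antisymm
  · exact Set.sInter_subset_of_mem ⟨hσ.isFaceOf_setOf_add_mem W,
      fun x hx => ⟨hx.2, 0, hσ.1, by simpa using hx.1⟩⟩
  · rintro x ⟨hx, y, hy, hxy⟩ τ ⟨hτ, hWτ⟩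
    exact (hτ.2.2 x hx y hy (hWτ ⟨hxy, hσ.2.1 x hx y hy⟩)).1

theorem IsConeSet.minFaceContaining_add_submodule {σ : Set V} (hσ : IsConeSet σ)
    (W : Submodule ℝ V) :
    minFaceContaining σ ((W : Set V) ∩ σ) + (W : Set V)
      = (σ + (W : Set V)) ∩ (-(σ + (W : Set V))) := by
  rw [hσ.minFaceContaining_submodule_inter W]
  apply Set.Subset.antisymm
  · rintro _ ⟨x, ⟨hx, y, hy, hxy⟩, w, hw, rfl⟩
    exact ⟨⟨x, hx, w, hw, rfl⟩, y, hy, -(x + y) - w, W.sub_mem (W.neg_mem hxy) hw,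
      by dsimp only; abel⟩
  · rintro _ ⟨⟨x, hx, w, hw, rfl⟩, y, hy, u, hu, h⟩
    refine ⟨x, ⟨hx, y, hy, ?_⟩, w, hw, rfl⟩
    have hsum : x + y = -(w + u) := by
      rw [eq_neg_iff_add_eq_zero, add_add_add_comm, add_comm, ← eq_neg_iff_add_eq_zero]
      exact h
    rw [hsum]
    exact W.neg_mem (W.add_mem hw hu)

end

/-- **Remark 5.3.**  For a convex polyhedral cone `σ` and a linear subspace `W`, the set
`Ŵ := σ_W + W` is the smallest face of the cone `σ + W`; in particular it equals
`(σ+W) ∩ −(σ+W)` and is a linear subspace of `V`.  Here `σ_W` denotes the smallest face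
of `σ` containing `W ∩ σ`. -/
theorem smallest_face_of_sum_with_subspace
    {V : Type*} [AddCommGroup V] [Module ℝ V] [FiniteDimensional ℝ V]
    (σ : Set V) (hσ : IsPolyCone σ) (W : Submodule ℝ V) :
    IsFaceOf (minFaceContaining σ ((W : Set V) ∩ σ) + (W : Set V)) (σ + (W : Set V)) ∧
      (∀ τ, IsFaceOf τ (σ + (W : Set V)) →
        minFaceContaining σ ((W : Set V) ∩ σ) + (W : Set V) ⊆ τ) ∧
      minFaceContaining σ ((W : Set V) ∩ σ) + (W : Set V)
        = (σ + (W : Set V)) ∩ (-(σ + (W : Set V))) ∧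
      ∃ U : Submodule ℝ V,
        (U : Set V) = minFaceContaining σ ((W : Set V) ∩ σ) + (W : Set V) := by
  have hC := hσ.isConeSet.add_submodule W
  rw [hσ.isConeSet.minFaceContaining_add_submodule W]
  exact ⟨hC.isFaceOf_inter_neg, fun τ hτ => hτ.inter_neg_subset, rfl, hC.lineality, rfl⟩
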